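/- Suppose the Q-action on Ĝ is trivial, i.e. q([ρ]) = [ρ] for all q ∈ Q and [ρ] ∈ Ĝ. Then for each q ∈ Q, the number of conjugacy classes of H contained in j⁻¹(⟨q⟩) (where ⟨q⟩ is the conjugacy class of q in Q) equals the number of classes [ρ] ∈ Ĝ such that c^{[ρ]}(q₁,q) = c^{[ρ]}(q,q₁) for all q₁ in the centralizer C_Q(q). -/

import Mathlib

noncomputable section

/-- A representation is irreducible if the space is nonzero and has no nontrivial invariant
subspace. -/
def IsIrredRep {K V : Type} [Group K] [AddCommGroup V] [Module ℂ V]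
    (ρ : Representation ℂ K V) : Prop :=
  Nontrivial V ∧
    ∀ W : Submodule ℂ V, (∀ (k : K), ∀ v ∈ W, ρ k v ∈ W) → W = ⊥ ∨ W = ⊤

/-- Two representations are isomorphic if there is an intertwining linear equivalence. -/
def RepIso {K V W : Type} [Group K] [AddCommGroup V] [Module ℂ V]
    [AddCommGroup W] [Module ℂ W]
    (ρ : Representation ℂ K V) (σ : Representation ℂ K W) : Prop :=
  ∃ e : V ≃ₗ[ℂ] W, ∀ (k : K) (v : V), e (ρ k v) = σ k (e v)

/-- The representation `g ↦ ρ (h·g·h⁻¹)` of the (normal) kernel of `j`, for `h : H`. -/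
def conjRep {H Q : Type} [Group H] [Group Q] (j : H →* Q) {V : Type}
    [AddCommGroup V] [Module ℂ V] (ρ : Representation ℂ j.ker V) (h : H) :
    Representation ℂ j.ker V :=
  MonoidHom.comp ρ (MulAut.conjNormal h).toMonoidHom

/-- `τ(q₁,q₂) := s q₁ * s q₂ * (s (q₁ q₂))⁻¹`, an element of `G = ker j`. -/
def tau {H Q : Type} [Group H] [Group Q] (j : H →* Q) (s : Q → H)
    (hs : ∀ q, j (s q) = q) (q₁ q₂ : Q) : j.ker :=
  ⟨s q₁ * s q₂ * (s (q₁ * q₂))⁻¹, by simp [MonoidHom.mem_ker, hs, mul_assoc]⟩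

/-- Transport along an equality of indices, as a linear map. -/
def castHom {Ghat : Type} (V : Ghat → Type) [∀ r, AddCommGroup (V r)]
    [∀ r, Module ℂ (V r)] {a b : Ghat} (h : a = b) : V a →ₗ[ℂ] V b where
  toFun v := cast (congrArg V h) v
  map_add' := by subst h; intros; rfl
  map_smul' := by subst h; intros; rfl

section IrreducibleRepresentations

variable {K : Type} [Group K] {V W : Type} [AddCommGroup V] [Module ℂ V] [AddCommGroup W]
  [Module ℂ W] {ρ : Representation ℂ K V} {σ : Representation ℂ K W}

/-- **Schur's lemma**: an endomorphism commuting with an irreducible representation is a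
scalar. -/
theorem IsIrredRep.exists_eq_smul_id [FiniteDimensional ℂ V] (hρ : IsIrredRep ρ)
    (M : V →ₗ[ℂ] V) (hM : ∀ g v, M (ρ g v) = ρ g (M v)) : ∃ a : ℂ, ∀ v, M v = a • v := by
  have := hρ.1
  obtain ⟨a, ha⟩ := Module.End.exists_eigenvalue M
  refine ⟨a, ?_⟩
  rcases hρ.2 (Module.End.eigenspace M a) fun k v hv => by
    rw [Module.End.mem_eigenspace_iff] at hv ⊢
    rw [hM, hv, map_smul] with h | h
  · exact absurd h ha
  · intro v
    rw [← Module.End.mem_eigenspace_iff, h]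
    trivial

/-- **Schur's lemma**: an intertwiner between non-isomorphic irreducible representations
vanishes. -/
theorem IsIrredRep.intertwiner_eq_zero (hρ : IsIrredRep ρ) (hσ : IsIrredRep σ)
    (hne : ¬ RepIso ρ σ) (M : V →ₗ[ℂ] W) (hM : ∀ g v, M (ρ g v) = σ g (M v)) : M = 0 := by
  by_contra h0
  have hker : LinearMap.ker M = ⊥ := by
    refine (hρ.2 (LinearMap.ker M) fun k v hv => ?_).resolve_right fun h => ?_
    · rw [LinearMap.mem_ker] at hv ⊢
      rw [hM, hv, map_zero]
    · exact h0 (LinearMap.ker_eq_top.1 h)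
  have hrange : LinearMap.range M = ⊤ := by
    refine (hσ.2 (LinearMap.range M) fun k v hv => ?_).resolve_left fun h => ?_
    · obtain ⟨u, rfl⟩ := hv
      exact ⟨ρ k u, hM k u⟩
    · exact h0 (LinearMap.range_eq_bot.1 h)
  exact hne ⟨LinearEquiv.ofBijective M
    ⟨LinearMap.ker_eq_bot.1 hker, LinearMap.range_eq_top.1 hrange⟩, fun k v => hM k v⟩

variable [Fintype K]

/-- The average of the linear map `M : V → W` over `K`, an intertwiner. -/
def averageHom (ρ : Representation ℂ K V) (σ : Representation ℂ K W) (M : V →ₗ[ℂ] W) :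
    V →ₗ[ℂ] W :=
  ∑ g, σ g ∘ₗ M ∘ₗ ρ g⁻¹

theorem averageHom_apply (M : V →ₗ[ℂ] W) (v : V) :
    averageHom ρ σ M v = ∑ g, σ g (M (ρ g⁻¹ v)) := by
  simp [averageHom]

theorem averageHom_intertwines (M : V →ₗ[ℂ] W) (k : K) (v : V) :
    averageHom ρ σ M (ρ k v) = σ k (averageHom ρ σ M v) := by
  rw [averageHom_apply, averageHom_apply, map_sum]
  refine Fintype.sum_equiv (Equiv.mulLeft k⁻¹) _ _ fun g => ?_
  simp [map_mul]

theorem sum_trace_smul [FiniteDimensional ℂ V] (S : V →ₗ[ℂ] V) (x : W) :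
    ∑ g, LinearMap.trace ℂ V (S ∘ₗ ρ g⁻¹) • σ g x =
      ∑ i, averageHom ρ σ (((Module.finBasis ℂ V).coord i ∘ₗ S).smulRight x)
        (Module.finBasis ℂ V i) := by
  simp only [averageHom_apply]
  rw [Finset.sum_comm]
  refine Finset.sum_congr rfl fun g _ => ?_
  rw [LinearMap.trace_eq_matrix_trace ℂ (Module.finBasis ℂ V), Matrix.trace, Finset.sum_smul]
  refine Finset.sum_congr rfl fun i _ => ?_
  simp [LinearMap.toMatrix_apply]

/-- Orthogonality of matrix coefficients of non-isomorphic irreducible representations. -/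
theorem IsIrredRep.sum_trace_smul_eq_zero [FiniteDimensional ℂ V] (hρ : IsIrredRep ρ)
    (hσ : IsIrredRep σ) (hne : ¬ RepIso ρ σ) (S : V →ₗ[ℂ] V) (x : W) :
    ∑ g, LinearMap.trace ℂ V (S ∘ₗ ρ g⁻¹) • σ g x = 0 := by
  rw [sum_trace_smul]
  refine Finset.sum_eq_zero fun i _ => ?_
  rw [hρ.intertwiner_eq_zero hσ hne _ (averageHom_intertwines _), LinearMap.zero_apply]

/-- Orthogonality of matrix coefficients of an irreducible representation. -/
theorem IsIrredRep.finrank_smul_sum_trace_smul [FiniteDimensional ℂ V] (hρ : IsIrredRep ρ)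
    (S : V →ₗ[ℂ] V) (x : V) :
    (Module.finrank ℂ V : ℂ) • ∑ g, LinearMap.trace ℂ V (S ∘ₗ ρ g⁻¹) • ρ g x =
      (Fintype.card K : ℂ) • S x := by
  have key : ∀ (M : V →ₗ[ℂ] V) (v : V), (Module.finrank ℂ V : ℂ) • averageHom ρ ρ M v =
      ((Fintype.card K : ℂ) * LinearMap.trace ℂ V M) • v := by
    intro M v
    obtain ⟨a, ha⟩ := hρ.exists_eq_smul_id _ (averageHom_intertwines (ρ := ρ) (σ := ρ) M)
    have h1 : averageHom ρ ρ M = a • LinearMap.id := by ext v; simp [ha]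
    have h2 : LinearMap.trace ℂ V (averageHom ρ ρ M) =
        Fintype.card K * LinearMap.trace ℂ V M := by
      have h3 : ∀ g, LinearMap.trace ℂ V (ρ g ∘ₗ M ∘ₗ ρ g⁻¹) = LinearMap.trace ℂ V M := by
        intro g
        rw [LinearMap.trace_comp_comm', LinearMap.comp_assoc]
        congr 1
        ext v
        simp
      rw [averageHom, map_sum, Finset.sum_congr rfl fun g _ => h3 g]
      simp
    rw [h1, map_smul, LinearMap.trace_id, smul_eq_mul] at h2
    rw [ha, smul_smul, mul_comm, h2]
  rw [sum_trace_smul, Finset.smul_sum]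
  simp only [key]
  conv_rhs => rw [← (Module.finBasis ℂ V).sum_repr (S x), Finset.smul_sum]
  refine Finset.sum_congr rfl fun i _ => ?_
  rw [LinearMap.trace_smulRight, smul_smul]
  simp

/-- A function on a finite group whose Fourier transform vanishes at all irreducible
representations is zero. -/
theorem eq_zero_of_forall_isIrredRep (a : K → ℂ)
    (h : ∀ (N : Type) [AddCommGroup N] [Module ℂ N] [FiniteDimensional ℂ N]
      (τ : Representation ℂ K N), IsIrredRep τ → ∀ v, ∑ g, a g • τ g v = 0) : a = 0 := by
  set A : MonoidAlgebra ℂ K := ∑ g, MonoidAlgebra.single g (a g) with hA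
  have hsimple : ∀ N : Submodule (MonoidAlgebra ℂ K) (MonoidAlgebra ℂ K),
      IsSimpleModule (MonoidAlgebra ℂ K) N → ∀ v ∈ N, A • v = 0 := by
    intro N hN v hv
    have hfd : FiniteDimensional ℂ N :=
      FiniteDimensional.finiteDimensional_submodule (N.restrictScalars ℂ)
    let τ : Representation ℂ K N := Representation.ofModule' N
    have hτ : ∀ (g : K) (w : N), τ g w = MonoidAlgebra.of ℂ K g • w := fun g w => rfl
    have hirr : IsIrredRep τ := by
      refine ⟨IsSimpleModule.nontrivial (MonoidAlgebra ℂ K) N, fun W hW => ?_⟩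
      rcases eq_bot_or_eq_top (MonoidAlgebra.submoduleOfSMulMem W hW) with h' | h'
      · left
        ext w
        exact SetLike.ext_iff.1 h' w
      · right
        ext w
        exact SetLike.ext_iff.1 h' w
    have := congrArg Subtype.val (h N τ hirr ⟨v, hv⟩)
    rw [hA, Finset.sum_smul]
    simpa [hτ, ← smul_mul_assoc] using this
  have hker : ∀ v ∈ (⊤ : Submodule (MonoidAlgebra ℂ K) (MonoidAlgebra ℂ K)), A • v = 0 := by
    rw [← IsSemisimpleModule.sSup_simples_eq_top]
    intro v hv
    rw [sSup_eq_iSup'] at hv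
    induction hv using Submodule.iSup_induction' with
    | mem N v hv => exact hsimple N.1 N.2 v hv
    | zero => simp
    | add v w _ _ hv hw => rw [smul_add, hv, hw, add_zero]
  have hA0 : A = 0 := by simpa using hker 1 trivial
  funext g
  classical
  simpa [hA, MonoidAlgebra.coeff_sum, Finsupp.single_apply] using
    congrArg (fun x : MonoidAlgebra ℂ K => x.coeff g) hA0

end IrreducibleRepresentations

section TwistedExtension

variable {H Q : Type} [Group H] [Group Q] {j : H →* Q} {s : Q → H}

/-- The component in `ker j` of `h` with respect to the section `s`. -/
def kerPart (j : H →* Q) (s : Q → H) (hs : ∀ q, j (s q) = q) (h : H) : j.ker :=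
  ⟨h * (s (j h))⁻¹, by simp [MonoidHom.mem_ker, hs]⟩

theorem kerPart_ker_mul (hs : ∀ q, j (s q) = q) (k : j.ker) (h : H) :
    kerPart j s hs (k * h) = k * kerPart j s hs h := by
  have hk : j (k : H) = 1 := k.2
  ext
  simp [kerPart, hk, mul_assoc]

theorem kerPart_mul (hs : ∀ q, j (s q) = q) (h₁ h₂ : H) :
    kerPart j s hs (h₁ * h₂) = kerPart j s hs h₁ *
      MulAut.conjNormal (s (j h₁)) (kerPart j s hs h₂) * tau j s hs (j h₁) (j h₂) := by
  ext
  simp [kerPart, tau, mul_assoc]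

variable {V : Type} [AddCommGroup V] [Module ℂ V]

/-- The operators `T q` intertwine `ρ` with its conjugates by `s q`, with cocycle `c`. -/
structure IsTwistedExtension (hs : ∀ q, j (s q) = q) (ρ : Representation ℂ j.ker V)
    (T : Q → V ≃ₗ[ℂ] V) (c : Q → Q → ℂ) : Prop where
  intertwines : ∀ q g v, T q (ρ (MulAut.conjNormal (s q) g) v) = ρ g (T q v)
  comp : ∀ q₁ q₂ v, T q₂ (T q₁ v) = c q₁ q₂ • T (q₁ * q₂) (ρ (tau j s hs q₁ q₂)⁻¹ v)

/-- The extension of the operators `T q` to all of `H`. -/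
def twist (hs : ∀ q, j (s q) = q) (ρ : Representation ℂ j.ker V) (T : Q → V ≃ₗ[ℂ] V) (h : H) :
    V →ₗ[ℂ] V :=
  (T (j h)).toLinearMap ∘ₗ ρ (kerPart j s hs h)⁻¹

variable {hs : ∀ q, j (s q) = q} {ρ : Representation ℂ j.ker V} {T : Q → V ≃ₗ[ℂ] V}
  {c : Q → Q → ℂ}

theorem twist_apply (h : H) (v : V) :
    twist hs ρ T h v = T (j h) (ρ (kerPart j s hs h)⁻¹ v) := rfl

theorem twist_bijective (h : H) : Function.Bijective (twist hs ρ T h) := by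
  have : Function.Bijective (ρ (kerPart j s hs h)⁻¹) :=
    Function.bijective_iff_has_inverse.2
      ⟨ρ (kerPart j s hs h), fun v => by simp, fun v => by simp⟩
  exact (T (j h)).bijective.comp this

theorem twist_ker_mul (k : j.ker) (h : H) :
    twist hs ρ T (k * h) = twist hs ρ T h ∘ₗ ρ k⁻¹ := by
  have hk : j (k : H) = 1 := k.2
  ext v
  simp [twist_apply, kerPart_ker_mul, hk]

theorem twist_section (q : Q) : twist hs ρ T (s q) = (T q).toLinearMap := by
  have h1 : kerPart j s hs (s q) = 1 := by
    ext
    simp [kerPart, hs]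
  ext v
  simp [twist_apply, h1, hs]

namespace IsTwistedExtension

theorem coeff_ne_zero (hE : IsTwistedExtension hs ρ T c) [Nontrivial V] (q₁ q₂ : Q) :
    c q₁ q₂ ≠ 0 := by
  intro h0
  obtain ⟨v, hv⟩ := exists_ne (0 : V)
  have := hE.comp q₁ q₂ v
  rw [h0, zero_smul] at this
  simp [hv] at this

theorem twist_conj (hE : IsTwistedExtension hs ρ T c) (h : H) (g : j.ker) (v : V) :
    twist hs ρ T h (ρ (MulAut.conjNormal h g) v) = ρ g (twist hs ρ T h v) := by
  rw [twist_apply, twist_apply, ← hE.intertwines, ← Module.End.mul_apply, ← Module.End.mul_apply,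
    ← map_mul, ← map_mul]
  congr 3
  ext
  simp [kerPart, mul_assoc]

theorem twist_mul (hE : IsTwistedExtension hs ρ T c) (h₁ h₂ : H) (v : V) :
    twist hs ρ T h₂ (twist hs ρ T h₁ v) = c (j h₁) (j h₂) • twist hs ρ T (h₁ * h₂) v := by
  simp only [twist_apply]
  rw [← hE.intertwines, hE.comp, kerPart_mul, map_mul j]
  simp [mul_assoc]

theorem trace_twist_conj (hE : IsTwistedExtension hs ρ T c) {h k : H}
    (hk : j k * j h = j h * j k) :
    c (j h) (j k) * LinearMap.trace ℂ V (twist hs ρ T h) =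
      c (j k) (j h) * LinearMap.trace ℂ V (twist hs ρ T (k * h * k⁻¹)) := by
  have hconj : j (k * h * k⁻¹) = j h := by simp [hk]
  let e : V ≃ₗ[ℂ] V := LinearEquiv.ofBijective (twist hs ρ T k) (twist_bijective k)
  have key : c (j h) (j k) • twist hs ρ T h =
      c (j k) (j h) • e.conj (twist hs ρ T (k * h * k⁻¹)) := by
    ext v
    obtain ⟨u, rfl⟩ := e.surjective v
    have h1 := hE.twist_mul k h u
    have h2 := hE.twist_mul (k * h * k⁻¹) k u
    rw [hconj, inv_mul_cancel_right] at h2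
    have h3 : e.conj (twist hs ρ T (k * h * k⁻¹)) (e u) =
        twist hs ρ T k (twist hs ρ T (k * h * k⁻¹) u) := by
      rw [LinearEquiv.conj_apply_apply, e.symm_apply_apply]
      rfl
    rw [LinearMap.smul_apply, LinearMap.smul_apply, h3, h2]
    change c (j h) (j k) • twist hs ρ T h (twist hs ρ T k u) = _
    rw [h1, smul_comm]
  have := congrArg (LinearMap.trace ℂ V) key
  rwa [map_smul, map_smul, LinearMap.trace_conj'] at this

end IsTwistedExtension

end TwistedExtension

section Fibre

variable {H Q : Type} [Group H] [Group Q] [Fintype H] {j : H →* Q}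

open Classical in
theorem sum_ker_mul [Fintype j.ker] {M : Type*} [AddCommMonoid M] (F : H → M) (h₀ : H) :
    ∑ g : j.ker, F (g * h₀) = ∑ h with j h = j h₀, F h := by
  refine Finset.sum_bij' (fun g _ => (g : H) * h₀)
    (fun h hh => ⟨h * h₀⁻¹, by simp_all [MonoidHom.mem_ker]⟩) ?_ ?_ ?_ ?_ ?_
  · intro g _
    have hg : j (g : H) = 1 := g.2
    simp [hg]
  all_goals simp

open Classical in
theorem sum_fibre_conj {M : Type*} [AddCommMonoid M] (F : H → M) {q : Q} {k : H}
    (hk : j k * q = q * j k) :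
    ∑ h with j h = q, F (k * h * k⁻¹) = ∑ h with j h = q, F h := by
  have hk' : (j k)⁻¹ * q * j k = q := by rw [mul_assoc, ← hk, inv_mul_cancel_left]
  refine Finset.sum_nbij' (fun h => k * h * k⁻¹) (fun h => k⁻¹ * h * k) ?_ ?_ ?_ ?_ ?_
  · intro h hh
    simp_all
  · intro h hh
    simp_all
  all_goals simp [mul_assoc]

/-- The twisted Fourier coefficient of a conjugation invariant function on a fibre of `j` vanishes
at a representation whose cocycle is not symmetric. -/
theorem sum_fibre_mul_trace_twist_eq_zero [Fintype j.ker] {s : Q → H} {hs : ∀ q, j (s q) = q}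
    {V : Type} [AddCommGroup V] [Module ℂ V] {ρ : Representation ℂ j.ker V}
    {T : Q → V ≃ₗ[ℂ] V} {c : Q → Q → ℂ} (hE : IsTwistedExtension hs ρ T c) {q q₁ : Q}
    (hq : q₁ * q = q * q₁) (hc : c q₁ q ≠ c q q₁) {f : H → ℂ}
    (hf : ∀ h k, j h = q → j k * q = q * j k → f (k * h * k⁻¹) = f h) :
    ∑ g : j.ker, f (g * s q) * LinearMap.trace ℂ V (twist hs ρ T (g * s q)) = 0 := by
  classical
  rw [sum_ker_mul (fun h => f h * LinearMap.trace ℂ V (twist hs ρ T h)) (s q), hs]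
  have hk : j (s q₁) * q = q * j (s q₁) := by rw [hs, hq]
  refine (mul_eq_mul_right_iff.1 ?_).resolve_left hc
  conv_lhs => rw [← sum_fibre_conj _ hk]
  rw [Finset.mul_sum, Finset.mul_sum]
  refine Finset.sum_congr rfl fun h hh => ?_
  have hh' : j h = q := (Finset.mem_filter.1 hh).2
  have := hE.trace_twist_conj (h := h) (k := s q₁) (by rw [hh', hk])
  rw [hf h _ hh' hk]
  rw [hh', hs] at this
  linear_combination -f h * this

/-- A conjugation invariant function on a fibre of `j` acts by zero in every irreducible
representation in which its twisted Fourier coefficient vanishes. -/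
theorem sum_fibre_smul_eq_zero [Fintype j.ker] {s : Q → H} {hs : ∀ q, j (s q) = q}
    {V : Type} [AddCommGroup V] [Module ℂ V] [FiniteDimensional ℂ V]
    {ρ : Representation ℂ j.ker V} (hρ : IsIrredRep ρ)
    {T : Q → V ≃ₗ[ℂ] V} {c : Q → Q → ℂ} (hE : IsTwistedExtension hs ρ T c) {q : Q} {f : H → ℂ}
    (hf : ∀ h k, j h = q → j k * q = q * j k → f (k * h * k⁻¹) = f h)
    (h0 : ∑ g : j.ker, f (g * s q) * LinearMap.trace ℂ V (twist hs ρ T (g * s q)) = 0) (v : V) :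
    ∑ g : j.ker, f (g⁻¹ * s q) • ρ g v = 0 := by
  classical
  have := hρ.1
  set M : V →ₗ[ℂ] V := ∑ g : j.ker, f (g * s q) • twist hs ρ T (g * s q) with hM
  have hM' : M = ∑ h with j h = q, f h • twist hs ρ T h := by
    rw [hM, sum_ker_mul (fun h => f h • twist hs ρ T h), hs]
  have hcomm : ∀ g v, M (ρ g v) = ρ g (M v) := by
    intro k v
    have hk : j (k : H)⁻¹ = 1 := k⁻¹.2
    have hkq : j (k : H)⁻¹ * q = q * j (k : H)⁻¹ := by rw [hk, one_mul, mul_one]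
    conv_rhs => rw [hM', ← sum_fibre_conj _ hkq]
    rw [hM', LinearMap.sum_apply, LinearMap.sum_apply, map_sum]
    refine Finset.sum_congr rfl fun h hh => ?_
    have hh' : j h = q := (Finset.mem_filter.1 hh).2
    rw [hf h _ hh' hkq, LinearMap.smul_apply, LinearMap.smul_apply, map_smul]
    have : (k : H)⁻¹ * h * (k : H)⁻¹⁻¹ =
        ((k⁻¹ * MulAut.conjNormal h k : j.ker) : H) * h := by simp [mul_assoc]
    rw [this, twist_ker_mul, LinearMap.comp_apply, ← hE.twist_conj, ← Module.End.mul_apply (ρ _),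
      ← map_mul]
    congr 4
    ext
    simp
  obtain ⟨a, ha⟩ := hρ.exists_eq_smul_id M hcomm
  have htr : LinearMap.trace ℂ V M = 0 := by
    rw [hM, map_sum, ← h0]
    exact Finset.sum_congr rfl fun g _ => by rw [map_smul, smul_eq_mul]
  have haid : M = a • LinearMap.id := by ext v; simp [ha]
  have ha0 : a = 0 := by
    rw [haid, map_smul, LinearMap.trace_id, smul_eq_mul] at htr
    exact (mul_eq_zero.1 htr).resolve_right (Nat.cast_ne_zero.2 Module.finrank_pos.ne')
  apply (T q).injective
  rw [map_zero, map_sum, ← zero_smul ℂ v, ← ha0, ← ha, hM, LinearMap.sum_apply]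
  refine Fintype.sum_equiv (Equiv.inv _) _ _ fun g => ?_
  rw [LinearMap.smul_apply, twist_ker_mul, twist_section]
  simp

end Fibre

section Counting

variable {H Q : Type} [Group H] [Group Q] {j : H →* Q} [Fintype j.ker] {s : Q → H}
  {hs : ∀ q, j (s q) = q} {Ghat : Type} {V : Ghat → Type} [∀ r, AddCommGroup (V r)]
  [∀ r, Module ℂ (V r)] [∀ r, FiniteDimensional ℂ (V r)]
  {ρ : ∀ r, Representation ℂ j.ker (V r)} {T : ∀ r, Q → V r ≃ₗ[ℂ] V r} {c : Ghat → Q → Q → ℂ}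

/-- A conjugation invariant function on a fibre of `j` is determined by its twisted Fourier
coefficients at the representations where the cocycle is symmetric. -/
theorem fibre_eq_zero_of_sum_trace_eq_zero [Fintype H]
    (hirr : ∀ r, IsIrredRep (ρ r))
    (hcomplete : ∀ (W : Type) [AddCommGroup W] [Module ℂ W] [FiniteDimensional ℂ W]
      (σ : Representation ℂ j.ker W), IsIrredRep σ → ∃ r, RepIso σ (ρ r))
    (hE : ∀ r, IsTwistedExtension hs (ρ r) (T r) (c r)) {q : Q} {f : H → ℂ}
    (hf : ∀ h k, j h = q → j k * q = q * j k → f (k * h * k⁻¹) = f h)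
    (h0 : ∀ r, (∀ q₁ ∈ Subgroup.centralizer ({q} : Set Q), c r q₁ q = c r q q₁) →
      ∑ g : j.ker, f (g * s q) * LinearMap.trace ℂ (V r) (twist hs (ρ r) (T r) (g * s q)) = 0)
    (h : H) (hh : j h = q) : f h = 0 := by
  have hall : ∀ r,
      ∑ g : j.ker, f (g * s q) * LinearMap.trace ℂ (V r) (twist hs (ρ r) (T r) (g * s q)) = 0 := by
    intro r
    by_cases hr : ∀ q₁ ∈ Subgroup.centralizer ({q} : Set Q), c r q₁ q = c r q q₁
    · exact h0 r hr
    · push Not at hr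
      obtain ⟨q₁, hq₁, hc⟩ := hr
      exact sum_fibre_mul_trace_twist_eq_zero (hE r)
        (Subgroup.mem_centralizer_singleton_iff.1 hq₁) hc hf
  have hfun : (fun g : j.ker => f (g⁻¹ * s q)) = 0 := by
    refine eq_zero_of_forall_isIrredRep _ ?_
    intro N _ _ _ τ hτ v
    obtain ⟨r, e, he⟩ := hcomplete N τ hτ
    apply e.injective
    rw [map_zero, map_sum, ← sum_fibre_smul_eq_zero (hirr r) (hE r) hf (hall r) (e v)]
    exact Finset.sum_congr rfl fun g _ => by rw [map_smul, he]
  have := congrFun hfun ⟨s q * h⁻¹, by simp [MonoidHom.mem_ker, hs, hh]⟩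
  simpa using this

/-- The traces of the twisted operators on a fibre of `j` are linearly independent. -/
theorem eq_zero_of_sum_trace_twist_eq_zero [Fintype Ghat] (hirr : ∀ r, IsIrredRep (ρ r))
    (hdist : ∀ r r', RepIso (ρ r) (ρ r') → r = r') {q : Q} {a : Ghat → ℂ}
    (h0 : ∀ h, j h = q →
      ∑ r, a r * LinearMap.trace ℂ (V r) (twist hs (ρ r) (T r) h) = 0) (r : Ghat) : a r = 0 := by
  have := (hirr r).1
  obtain ⟨v, hv⟩ := exists_ne (0 : V r)
  have hg : ∀ g : j.ker,
      ∑ r, a r * LinearMap.trace ℂ (V r) ((T r q).toLinearMap ∘ₗ ρ r g⁻¹) = 0 := by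
    intro g
    have hjg : j (g : H) = 1 := g.2
    rw [← h0 (g * s q) (by rw [map_mul, hs, hjg, one_mul])]
    simp only [twist_ker_mul, twist_section]
  have hsum : a r • ∑ g, LinearMap.trace ℂ (V r) ((T r q).toLinearMap ∘ₗ ρ r g⁻¹) • ρ r g v = 0 := by
    calc _ = ∑ r', a r' •
          ∑ g, LinearMap.trace ℂ (V r') ((T r' q).toLinearMap ∘ₗ ρ r' g⁻¹) • ρ r g v := by
          rw [Fintype.sum_eq_single r]
          intro r' hr'
          rw [(hirr r').sum_trace_smul_eq_zero (hirr r) (fun h => hr' (hdist _ _ h)), smul_zero]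
      _ = ∑ g, (∑ r', a r' * LinearMap.trace ℂ (V r') ((T r' q).toLinearMap ∘ₗ ρ r' g⁻¹)) •
          ρ r g v := by
          simp only [Finset.smul_sum, Finset.sum_smul, smul_smul]
          exact Finset.sum_comm
      _ = 0 := by simp [hg]
  have hd := (hirr r).finrank_smul_sum_trace_smul (T r q).toLinearMap v
  have h1 : a r • (Fintype.card j.ker : ℂ) • T r q v = 0 := by
    rw [← LinearEquiv.coe_coe, ← hd, smul_comm, hsum, smul_zero]
  simpa [hv] using h1

/-- The number of conjugacy classes of `H` meeting the fibre of `j` over `q` is the number of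
irreducible representations of `ker j` whose cocycle is symmetric at `q`. -/
theorem card_conjClasses_fibre [Fintype Ghat] [Fintype H]
    (hirr : ∀ r, IsIrredRep (ρ r))
    (hdist : ∀ r r', RepIso (ρ r) (ρ r') → r = r')
    (hcomplete : ∀ (W : Type) [AddCommGroup W] [Module ℂ W] [FiniteDimensional ℂ W]
      (σ : Representation ℂ j.ker W), IsIrredRep σ → ∃ r, RepIso σ (ρ r))
    (hE : ∀ r, IsTwistedExtension hs (ρ r) (T r) (c r)) (q : Q) :
    Nat.card {γ : ConjClasses H // ∃ h : H, γ = ConjClasses.mk h ∧ IsConj q (j h)} =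
      Nat.card {r : Ghat //
        ∀ q₁ ∈ Subgroup.centralizer ({q} : Set Q), c r q₁ q = c r q q₁} := by
  classical
  set X := {γ : ConjClasses H // ∃ h : H, γ = ConjClasses.mk h ∧ IsConj q (j h)}
  set R := {r : Ghat // ∀ q₁ ∈ Subgroup.centralizer ({q} : Set Q), c r q₁ q = c r q q₁}
  have hrep : ∀ x : X, ∃ h, j h = q ∧ ConjClasses.mk h = x.1 := by
    rintro ⟨γ, h, rfl, hc⟩
    obtain ⟨d, hd⟩ := isConj_iff.1 hc
    refine ⟨(s d)⁻¹ * h * s d, ?_, ?_⟩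
    · simp [hs, ← hd, mul_assoc]
    · exact ConjClasses.mk_eq_mk_iff_isConj.2 (isConj_iff.2 ⟨s d, by simp [mul_assoc]⟩)
  choose rep hrepj hrepmk using hrep
  have hX : ∀ h, j h = q → ∃ h' : H, ConjClasses.mk h = ConjClasses.mk h' ∧ IsConj q (j h') :=
    fun h hh => ⟨h, rfl, by rw [hh]⟩
  let cls (h : H) (hh : j h = q) : X := ⟨ConjClasses.mk h, hX h hh⟩
  have hker : ∀ g : j.ker, j (g * s q) = q := fun g => by
    have hg : j (g : H) = 1 := g.2
    rw [map_mul, hg, hs, one_mul]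
  let Φ : (X → ℂ) →ₗ[ℂ] (R → ℂ) := LinearMap.pi fun r => ∑ g : j.ker,
    LinearMap.trace ℂ (V r) (twist hs (ρ r) (T r) (g * s q)) •
      LinearMap.proj (cls (g * s q) (hker g))
  let Ψ : (R → ℂ) →ₗ[ℂ] (X → ℂ) := LinearMap.pi fun x => ∑ r : R,
    LinearMap.trace ℂ (V r) (twist hs (ρ r) (T r) (rep x)) • LinearMap.proj r
  have hΦ : Function.Injective Φ := by
    refine (injective_iff_map_eq_zero _).2 fun x hx => ?_
    let f : H → ℂ := fun h => if hh : j h = q then x (cls h hh) else 0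
    have hf0 : ∀ h, j h = q → f h = 0 := by
      refine fibre_eq_zero_of_sum_trace_eq_zero hirr hcomplete hE ?_ ?_
      · intro h k hh hk
        have hh' : j (k * h * k⁻¹) = q := by simp [hh, hk]
        simp only [f, dif_pos hh, dif_pos hh']
        congr 1
        exact Subtype.ext (ConjClasses.mk_eq_mk_iff_isConj.2
          (isConj_iff.2 ⟨k, rfl⟩)).symm
      · intro r hr
        have := congrFun hx ⟨r, hr⟩
        simp_rw [mul_comm (f _)]
        simpa [Φ, f, hker] using this
    funext y
    have := hf0 (rep y) (hrepj y)
    simp only [f, dif_pos (hrepj y)] at this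
    rw [Pi.zero_apply, ← this]
    congr 1
    exact Subtype.ext (hrepmk y).symm
  have hΨ : Function.Injective Ψ := by
    refine (injective_iff_map_eq_zero _).2 fun a ha => ?_
    let b : Ghat → ℂ := fun r => if hr : _ then a ⟨r, hr⟩ else 0
    have hb : ∀ r : R, b r = a r := fun r => dif_pos r.2
    have hb0 : ∀ r, b r = 0 := by
      refine eq_zero_of_sum_trace_twist_eq_zero (hs := hs) (T := T) (q := q) hirr hdist ?_
      intro h hh
      obtain ⟨k, hk⟩ := isConj_iff.1 (ConjClasses.mk_eq_mk_iff_isConj.1 (hrepmk (cls h hh)).symm)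
      have hkq : j k * q = q * j k := by
        have := congrArg j hk
        rw [map_mul, map_mul, hh, hrepj, map_inv] at this
        exact mul_inv_eq_iff_eq_mul.1 this
      have hx := congrFun ha (cls h hh)
      rw [Pi.zero_apply] at hx
      rw [← hx, LinearMap.pi_apply, LinearMap.sum_apply]
      refine (Fintype.sum_of_injective _ Subtype.val_injective _ _ (fun r hr => ?_)
        fun r => ?_).symm
      · simp only [b]
        rw [dif_neg fun hr' => hr ⟨⟨r, hr'⟩, rfl⟩, zero_mul]
      · have := (hirr r).1
        have hc := r.2 (j k) (Subgroup.mem_centralizer_singleton_iff.2 hkq)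
        have htr := (hE r).trace_twist_conj (h := h) (k := k) (by rw [hh, hkq])
        rw [hk, hh, hc] at htr
        rw [hb, mul_left_cancel₀ ((hE r).coeff_ne_zero _ _) htr, mul_comm]
        rfl
    funext r
    rw [← hb, hb0, Pi.zero_apply]
  have h1 := LinearMap.finrank_le_finrank_of_injective hΦ
  have h2 := LinearMap.finrank_le_finrank_of_injective hΨ
  rw [Module.finrank_fintype_fun_eq_card, Module.finrank_fintype_fun_eq_card] at h1 h2
  rw [Nat.card_eq_fintype_card, Nat.card_eq_fintype_card]
  exact le_antisymm h1 h2

end Counting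

/-- Suppose the `Q`-action on `Ĝ` is trivial.  Then for each `q ∈ Q`, the
number of conjugacy classes of `H` contained in `j⁻¹(⟨q⟩)` equals the number of classes
`[ρ] ∈ Ĝ` such that `c^{[ρ]}(q₁,q) = c^{[ρ]}(q,q₁)` for all `q₁` in the centralizer
`C_Q(q)`. -/
theorem stmt15 {H Q : Type} [Group H] [Group Q] [Fintype H] [Fintype Q]
    (j : H →* Q) (hj : Function.Surjective j)
    (s : Q → H) (hs : ∀ q, j (s q) = q) (hs1 : s 1 = 1)
    {Ghat : Type} [Fintype Ghat]
    (V : Ghat → Type) [∀ r, AddCommGroup (V r)] [∀ r, Module ℂ (V r)]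
    [∀ r, FiniteDimensional ℂ (V r)]
    (ρ : ∀ r, Representation ℂ j.ker (V r))
    (hirr : ∀ r, IsIrredRep (ρ r))
    (hdist : ∀ r r', RepIso (ρ r) (ρ r') → r = r')
    (hcomplete : ∀ (W : Type) [AddCommGroup W] [Module ℂ W] [FiniteDimensional ℂ W]
      (σ : Representation ℂ j.ker W), IsIrredRep σ → ∃ r, RepIso σ (ρ r))
    (act : Q → Ghat → Ghat)
    (hact : ∀ q r, RepIso (conjRep j (ρ r) (s q)) (ρ (act q r)))
    (hact1 : ∀ r, act 1 r = r)
    (hactmul : ∀ (q₁ q₂ : Q) (r : Ghat), act q₂ (act q₁ r) = act (q₁ * q₂) r)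
    (T : ∀ (q : Q) (r : Ghat), V r ≃ₗ[ℂ] V (act q r))
    (hT : ∀ (q : Q) (r : Ghat) (g : j.ker) (v : V r),
      T q r (conjRep j (ρ r) (s q) g v) = ρ (act q r) g (T q r v))
    (hT1 : ∀ (r : Ghat) (v : V r), T 1 r v = castHom V (hact1 r).symm v)
    (c : Ghat → Q → Q → ℂ)
    (hcdef : ∀ (r : Ghat) (q₁ q₂ : Q) (v : V r),
      T q₂ (act q₁ r) (T q₁ r v) =
        c r q₁ q₂ • castHom V (hactmul q₁ q₂ r).symm
          (T (q₁ * q₂) r (ρ r ((tau j s hs q₁ q₂)⁻¹) v)))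
    -- the `Q`-action on `Ĝ` is trivial
    (htriv : ∀ (q : Q) (r : Ghat), act q r = r)
    (q : Q) :
    Nat.card {γ : ConjClasses H // ∃ h : H, γ = ConjClasses.mk h ∧ IsConj q (j h)} =
      Nat.card {r : Ghat //
        ∀ q₁ ∈ Subgroup.centralizer ({q} : Set Q), c r q₁ q = c r q q₁} := by
  classical
  obtain rfl : act = fun _ r => r := funext fun q => funext fun r => htriv q r
  exact card_conjClasses_fibre (hs := hs) (T := fun r q => T q r) hirr hdist hcomplete
    (fun r => ⟨fun q g v => hT q r g v, fun q₁ q₂ v => by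
      simpa [castHom] using hcdef r q₁ q₂ v⟩) q
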